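/- arXiv:0809.0225 — 3 statements merged into one kernel-verified Lean document; each statement's English description precedes it below -/
import Mathlib

section
/- For every even integer g ≥ 2, the sublattice {v ∈ Λ_g : B_g(v₁,v) = 0 and B_g(e,v) = 0} of Λ_g is exactly the ℤ-span of the two vectors w₁ = (1, 0, −g/2, (g−4)/4) and w₂ = (0, 1, −(3g−6)/2, (7g−40)/12). (This computes the numerical Grothendieck group K₀(A_X)_num of the component A_X = ⟨E₂, O_X⟩^⊥ of the derived category of a Fano threefold X of index 1 and even genus g.) -/
/-!
Model of the numerical Grothendieck group of a Fano threefold of index 1 and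
genus `g`: on `ℚ⁴` (quadruples `(x, y, z, w)` of coordinates w.r.t. the classes
`1, H, L, P`) we define the commutative multiplication with unit `e₀` given by
`e₁·e₁ = (2g−2)·e₂`, `e₁·e₂ = e₂·e₁ = e₃` and all other products among
`e₁, e₂, e₃` equal to `0`; the involution `σ(x,y,z,w) = (x,−y,z,−w)`; the
linear functional `χ₀(x,y,z,w) = x + ((g+11)/6)·y + (1/2)·z + w`; and the
Euler pairing `B_g(u,v) = χ₀(σ(u)·v)`.  The lattice `Λ_g` is the ℤ-span of
`v₁ = (1,0,0,0)`, `v₂ = (0,1,−(g−1),(g−1)/3)`, `v₃ = (0,0,1,1/2)`,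
`v₄ = (0,0,0,1)`.
-/

namespace Fano

/-- The even cohomology `ℚ⁴`, with coordinates in degrees `0, 2, 4, 6`. -/
abbrev V4 : Type := ℚ × ℚ × ℚ × ℚ

/-- The multiplication on `ℚ⁴` for the index 1, genus `g` model:
`e₀` is the unit, `e₁·e₁ = (2g−2)·e₂`, `e₁·e₂ = e₂·e₁ = e₃`, and all other
products among `e₁, e₂, e₃` vanish. -/
def mulg (g : ℚ) (u v : V4) : V4 :=
  (u.1 * v.1,
   u.1 * v.2.1 + u.2.1 * v.1,
   u.1 * v.2.2.1 + u.2.2.1 * v.1 + (2 * g - 2) * (u.2.1 * v.2.1),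
   u.1 * v.2.2.2 + u.2.2.2 * v.1 + u.2.1 * v.2.2.1 + u.2.2.1 * v.2.1)

/-- The involution `σ(x,y,z,w) = (x,−y,z,−w)` (i.e. `(−1)^p` on `H^{2p}`). -/
def sigmaV (u : V4) : V4 := (u.1, -u.2.1, u.2.2.1, -u.2.2.2)

/-- The linear functional `χ₀(x,y,z,w) = x + ((g+11)/6)·y + (1/2)·z + w`. -/
def chi0 (g : ℚ) (u : V4) : ℚ :=
  u.1 + (g + 11) / 6 * u.2.1 + u.2.2.1 / 2 + u.2.2.2

/-- The Euler pairing `B_g(u,v) = χ₀(σ(u)·v)`. -/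
def B (g : ℚ) (u v : V4) : ℚ := chi0 g (mulg g (sigmaV u) v)

/-- `v₁ = ch(O_X) = (1,0,0,0)`. -/
def v1 : V4 := (1, 0, 0, 0)

/-- `v₂ = ch(O_H) = (0,1,−(g−1),(g−1)/3)`. -/
def v2 (g : ℚ) : V4 := (0, 1, -(g - 1), (g - 1) / 3)

/-- `v₃ = ch(O_L) = (0,0,1,1/2)`. -/
def v3 : V4 := (0, 0, 1, 1 / 2)

/-- `v₄ = ch(O_P) = (0,0,0,1)`. -/
def v4 : V4 := (0, 0, 0, 1)

/-- Membership in the lattice `Λ_g`, the ℤ-span of `v₁, v₂, v₃, v₄`. -/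
def memLambda (g : ℚ) (v : V4) : Prop :=
  ∃ a b c d : ℤ, v = a • v1 + b • v2 g + c • v3 + d • v4

/-- `e = ch(E₂) = (2, −1, (g−4)/2, −(g−10)/12)`, the Chern character of the
rank-2 Mukai bundle `E₂`. -/
def mukaiE (g : ℚ) : V4 := (2, -1, (g - 4) / 2, -(g - 10) / 12)

/-- `w₁ = (1, 0, −g/2, (g−4)/4)`. -/
def w1 (g : ℚ) : V4 := (1, 0, -g / 2, (g - 4) / 4)

/-- `w₂ = (0, 1, −(3g−6)/2, (7g−40)/12)`. -/
def w2 (g : ℚ) : V4 := (0, 1, -(3 * g - 6) / 2, (7 * g - 40) / 12)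

/-- for every even integer `g ≥ 2`, the sublattice
`{v ∈ Λ_g : B_g(v₁,v) = 0 and B_g(e,v) = 0}` is exactly the ℤ-span of
`w₁ = (1, 0, −g/2, (g−4)/4)` and `w₂ = (0, 1, −(3g−6)/2, (7g−40)/12)`
(the numerical Grothendieck group `K₀(A_X)_num`). -/
theorem K0_of_A_X_computation (g : ℤ) (hg : Even g) (hg2 : 2 ≤ g) (v : V4) :
    (memLambda (g : ℚ) v ∧ B (g : ℚ) v1 v = 0 ∧ B (g : ℚ) (mukaiE (g : ℚ)) v = 0) ↔
    (∃ a b : ℤ, v = a • w1 (g : ℚ) + b • w2 (g : ℚ)) := by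
  obtain ⟨x, y, z, w⟩ := v
  obtain ⟨k, rfl⟩ := hg
  simp only [memLambda, B, chi0, mulg, sigmaV, mukaiE, v1, v2, v3, v4, w1, w2, zsmul_eq_mul,
    Prod.smul_mk, Prod.mk_add_mk, Prod.mk.injEq]
  push_cast
  constructor
  · rintro ⟨⟨a, b, c, d, hx, hy, -, -⟩, h1, h2⟩
    ring_nf at hx hy
    subst hx hy
    refine ⟨a, b, by ring, by ring, ?_, ?_⟩
    · linear_combination h2 - 2 * h1
    · linear_combination 2 * h1 - h2 / 2
  · rintro ⟨a, b, rfl, rfl, rfl, rfl⟩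
    refine ⟨⟨a, b, -k * a + (2 - k) * b, (k - 1) * a + (k - 4) * b, ?_, ?_, ?_, ?_⟩, ?_, ?_⟩ <;>
      · push_cast
        ring

end Fano
end

section
/- For every integer d, the sublattice {v ∈ Λ'_d : B'_d(v₁,v) = 0 and B'_d(u,v) = 0} of Λ'_d is exactly the ℤ-span of the two vectors w₁' = (1, 0, −1, 0) and w₂' = (0, 1, −d/2, (d−6)/6). (This computes the numerical Grothendieck group K₀(B_Y)_num of the component B_Y = ⟨O_Y, O_Y(H)⟩^⊥ of the derived category of a Fano threefold Y of index 2 and degree d.) -/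
/-!
Model of the numerical Grothendieck group of a Fano threefold of index 2 and
degree `d`: on `ℚ⁴` (quadruples `(x, y, z, w)` of coordinates w.r.t. the
classes `1, H, L, P`) we define the commutative multiplication with unit `e₀`
given by `e₁·e₁ = d·e₂`, `e₁·e₂ = e₂·e₁ = e₃` and all other products among
`e₁, e₂, e₃` equal to `0`; the involution `σ(x,y,z,w) = (x,−y,z,−w)`; the
linear functional `χ₀'(x,y,z,w) = x + ((d+3)/3)·y + z + w`; and the Euler
pairing `B'_d(u,v) = χ₀'(σ(u)·v)`.  The lattice `Λ'_d` is the ℤ-span of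
`v₁ = (1,0,0,0)`, `v₂ = (0,1,−d/2,d/6)`, `v₃ = (0,0,1,0)`, `v₄ = (0,0,0,1)`.
-/

namespace Fano

/-- The multiplication on `ℚ⁴` for the index 2, degree `d` model:
`e₀` is the unit, `e₁·e₁ = d·e₂`, `e₁·e₂ = e₂·e₁ = e₃`, and all other
products among `e₁, e₂, e₃` vanish. -/
def muld (d : ℚ) (u v : V4) : V4 :=
  (u.1 * v.1,
   u.1 * v.2.1 + u.2.1 * v.1,
   u.1 * v.2.2.1 + u.2.2.1 * v.1 + d * (u.2.1 * v.2.1),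
   u.1 * v.2.2.2 + u.2.2.2 * v.1 + u.2.1 * v.2.2.1 + u.2.2.1 * v.2.1)

/-- The linear functional `χ₀'(x,y,z,w) = x + ((d+3)/3)·y + z + w`. -/
def chi0' (d : ℚ) (u : V4) : ℚ :=
  u.1 + (d + 3) / 3 * u.2.1 + u.2.2.1 + u.2.2.2

/-- The Euler pairing `B'_d(u,v) = χ₀'(σ(u)·v)`. -/
def B' (d : ℚ) (u v : V4) : ℚ := chi0' d (muld d (sigmaV u) v)

/-- `v₂ = ch(O_H) = (0,1,−d/2,d/6)`. -/
def v2' (d : ℚ) : V4 := (0, 1, -d / 2, d / 6)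

/-- `v₃ = ch(O_L) = (0,0,1,0)`. -/
def v3' : V4 := (0, 0, 1, 0)

/-- Membership in the lattice `Λ'_d`, the ℤ-span of `v₁, v₂, v₃, v₄`. -/
def memLambda' (d : ℚ) (v : V4) : Prop :=
  ∃ a b c e : ℤ, v = a • v1 + b • v2' d + c • v3' + e • v4

/-- `u = ch(O_Y(H)) = (1, 1, d/2, d/6)`. -/
def uH (d : ℚ) : V4 := (1, 1, d / 2, d / 6)

/-- `w₁' = (1, 0, −1, 0)`. -/
def w1' : V4 := (1, 0, -1, 0)

/-- `w₂' = (0, 1, −d/2, (d−6)/6)`. -/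
def w2' (d : ℚ) : V4 := (0, 1, -d / 2, (d - 6) / 6)

/-- for every integer `d`, the sublattice
`{v ∈ Λ'_d : B'_d(v₁,v) = 0 and B'_d(u,v) = 0}` is exactly the ℤ-span of
`w₁' = (1, 0, −1, 0)` and `w₂' = (0, 1, −d/2, (d−6)/6)`
(the numerical Grothendieck group `K₀(B_Y)_num`). -/
theorem K0_of_B_Y_computation (d : ℤ) (v : V4) :
    (memLambda' (d : ℚ) v ∧ B' (d : ℚ) v1 v = 0 ∧ B' (d : ℚ) (uH (d : ℚ)) v = 0) ↔
    (∃ a b : ℤ, v = a • w1' + b • w2' (d : ℚ)) := by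
  constructor
  · rintro ⟨⟨a, b, c, e, rfl⟩, h₁, h₂⟩
    simp only [B', chi0', muld, sigmaV, uH, v1, v2', v3', v4, Prod.smul_mk, Prod.mk_add_mk,
      zsmul_eq_mul] at h₁ h₂
    have he : (e : ℚ) = -b := by linear_combination h₂
    have hc : (c : ℚ) = -a := by linear_combination h₁ - h₂
    refine ⟨a, b, ?_⟩
    simp only [v1, v2', v3', v4, w1', w2', Prod.smul_mk, Prod.mk_add_mk, zsmul_eq_mul,
      Prod.mk.injEq, he, hc]
    refine ⟨?_, ?_, ?_, ?_⟩ <;> ring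
  · rintro ⟨a, b, rfl⟩
    refine ⟨⟨a, b, -a, -b, ?_⟩, ?_, ?_⟩
    · simp only [v1, v2', v3', v4, w1', w2', Prod.smul_mk, Prod.mk_add_mk, zsmul_eq_mul,
        Prod.mk.injEq, Int.cast_neg]
      refine ⟨?_, ?_, ?_, ?_⟩ <;> ring
    all_goals
      simp only [B', chi0', muld, sigmaV, uH, v1, w1', w2', Prod.smul_mk, Prod.mk_add_mk,
        zsmul_eq_mul]
      ring

end Fano
end

section
/- For every integer d ≥ 1, setting g = 2d + 2, there exists an isomorphism of abelian groups φ from the lattice L_B = {v ∈ Λ'_d : B'_d(v₁,v) = 0 and B'_d(u,v) = 0} to the lattice L_A = {v ∈ Λ_g : B_g(v₁,v) = 0 and B_g(e,v) = 0} which is compatible with the Euler pairings, i.e. B_g(φ(a), φ(b)) = B'_d(a, b) for all a, b ∈ L_B. (This is the statement that the numerical Grothendieck groups K₀(A_{X_{4d+2}})_num and K₀(B_{Y_d})_num of the nontrivial components of the derived categories of a Fano threefold of index 1 and degree 4d+2 and a Fano threefold of index 2 and degree d are isomorphic as lattices with bilinear forms.) -/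
/-!
STATEMENT 9.  Two models on `ℚ⁴` (quadruples `(x, y, z, w)` of coordinates
w.r.t. the classes `1, H, L, P`), both with the involution
`σ(x,y,z,w) = (x,−y,z,−w)`.

Index-1 model (genus `g`): multiplication with unit `e₀` given by
`e₁·e₁ = (2g−2)·e₂`, `e₁·e₂ = e₂·e₁ = e₃`, all other products among
`e₁, e₂, e₃` zero; `χ₀(x,y,z,w) = x + ((g+11)/6)·y + z/2 + w`; Euler pairing
`B_g(u,v) = χ₀(σ(u)·v)`; lattice `Λ_g` spanned over ℤ by `v₁ = (1,0,0,0)`,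
`v₂ = (0,1,−(g−1),(g−1)/3)`, `v₃ = (0,0,1,1/2)`, `v₄ = (0,0,0,1)`;
`e = (2,−1,(g−4)/2,−(g−10)/12)` is the Chern character of the Mukai bundle.

Index-2 model (degree `d`): multiplication with unit `e₀` given by
`e₁·e₁ = d·e₂`, `e₁·e₂ = e₂·e₁ = e₃`, all other products among `e₁, e₂, e₃`
zero; `χ₀'(x,y,z,w) = x + ((d+3)/3)·y + z + w`; Euler pairing
`B'_d(u,v) = χ₀'(σ(u)·v)`; lattice `Λ'_d` spanned over ℤ by `v₁ = (1,0,0,0)`,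
`v₂' = (0,1,−d/2,d/6)`, `v₃' = (0,0,1,0)`, `v₄ = (0,0,0,1)`;
`u = (1,1,d/2,d/6)` is the Chern character of `O_Y(H)`.
-/

namespace Fano

/-! ### The two sublattices -/

/-- `L_B = K₀(B_{Y_d})_num = {v ∈ Λ'_d : B'_d(v₁,v) = 0 and B'_d(u,v) = 0}`. -/
def LB (d : ℚ) : Set V4 :=
  {v | memLambda' d v ∧ B' d v1 v = 0 ∧ B' d (uH d) v = 0}

/-- `L_A = K₀(A_{X_{2g−2}})_num = {v ∈ Λ_g : B_g(v₁,v) = 0 and B_g(e,v) = 0}`. -/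
def LA (g : ℚ) : Set V4 :=
  {v | memLambda g v ∧ B g v1 v = 0 ∧ B g (mukaiE g) v = 0}

/-- The element of `L_B ⊗ ℚ` with given coordinates in degrees `0` and `2`. -/
def pointLB (d x y : ℚ) : V4 := (x, y, -x - d / 2 * y, (d / 6 - 1) * y)

/-- The element of `L_A ⊗ ℚ`, for genus `2d + 2`, with given coordinates in degrees
`0` and `2`. -/
def pointLA (d x y : ℚ) : V4 :=
  (x, y, -(d + 1) * x - 3 * d * y, (d - 1) / 2 * x + (7 * d - 13) / 6 * y)

theorem mem_LB_iff (d : ℚ) (v : V4) :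
    v ∈ LB d ↔ ∃ a b : ℤ, v = pointLB d a b := by
  constructor
  · rintro ⟨⟨a, b, c, e, rfl⟩, h1, h2⟩
    refine ⟨a, b, ?_⟩
    simp [B', chi0', muld, sigmaV, uH, v1, v2', v3', v4] at h1 h2
    ext <;> simp [pointLB, v1, v2', v3', v4] <;> linarith
  · rintro ⟨a, b, rfl⟩
    refine ⟨⟨a, b, -a, -b, ?_⟩, ?_, ?_⟩
    · ext <;> simp [pointLB, v1, v2', v3', v4] <;> ring
    · simp [pointLB, B', chi0', muld, sigmaV, v1]
      ring
    · simp [pointLB, B', chi0', muld, sigmaV, uH]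
      ring

theorem mem_LA_iff (d : ℤ) (v : V4) :
    v ∈ LA (2 * (d : ℚ) + 2) ↔ ∃ a b : ℤ, v = pointLA d a b := by
  constructor
  · rintro ⟨⟨a, b, c, e, rfl⟩, h1, h2⟩
    refine ⟨a, b, ?_⟩
    simp [B, chi0, mulg, sigmaV, mukaiE, v1, v2, v3, v4] at h1 h2
    ext <;> simp [pointLA, v1, v2, v3, v4] <;> linarith
  · rintro ⟨a, b, rfl⟩
    refine ⟨⟨a, b, -(d + 1) * a + (1 - d) * b, d * a + (d - 3) * b, ?_⟩, ?_, ?_⟩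
    · ext <;> simp [pointLA, v1, v2, v3, v4] <;> ring
    · simp [pointLA, B, chi0, mulg, sigmaV, v1]
      ring
    · simp [pointLA, B, chi0, mulg, sigmaV, mukaiE]
      ring

/-- The additive map sending the basis `pointLB d 1 0`, `pointLB d 0 1` of `L_B` to
`pointLA d 2 (-1)`, `pointLA d 1 0`. -/
def isoLBLA (d : ℚ) : V4 →+ V4 where
  toFun v := pointLA d (2 * v.1 + v.2.1) (-v.1)
  map_zero' := by simp [pointLA]
  map_add' u v := by ext <;> simp [pointLA] <;> ring

theorem isoLBLA_pointLB (d x y : ℚ) :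
    isoLBLA d (pointLB d x y) = pointLA d (2 * x + y) (-x) := rfl

theorem B_isoLBLA_pointLB (d x y x' y' : ℚ) :
    B (2 * d + 2) (isoLBLA d (pointLB d x y)) (isoLBLA d (pointLB d x' y')) =
      B' d (pointLB d x y) (pointLB d x' y') := by
  rw [isoLBLA_pointLB, isoLBLA_pointLB]
  simp only [pointLA, pointLB, B, B', chi0, chi0', mulg, muld, sigmaV]
  ring

/-- for every integer `d ≥ 1`, setting `g = 2d + 2`, there is an
isomorphism of abelian groups from `L_B` onto `L_A` compatible with the Euler
pairings; formally, an additive map `φ` of the ambient group restricting to a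
bijection of `L_B` onto `L_A` with `B_g(φ(a), φ(b)) = B'_d(a, b)` for all
`a, b ∈ L_B`. -/
theorem K0_A_iso_K0_B (d : ℤ) (hd : 1 ≤ d) :
    ∃ φ : V4 →+ V4,
      Set.BijOn φ (LB (d : ℚ)) (LA (2 * (d : ℚ) + 2)) ∧
      ∀ a ∈ LB (d : ℚ), ∀ b ∈ LB (d : ℚ),
        B (2 * (d : ℚ) + 2) (φ a) (φ b) = B' (d : ℚ) a b := by
  refine ⟨isoLBLA d, ⟨?_, ?_, ?_⟩, ?_⟩
  · intro v hv
    obtain ⟨a, b, rfl⟩ := (mem_LB_iff _ _).1 hv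
    exact (mem_LA_iff _ _).2 ⟨2 * a + b, -a, by rw [isoLBLA_pointLB]; push_cast; rfl⟩
  · intro u hu v hv h
    obtain ⟨a, b, rfl⟩ := (mem_LB_iff _ _).1 hu
    obtain ⟨a', b', rfl⟩ := (mem_LB_iff _ _).1 hv
    simp only [isoLBLA_pointLB, pointLA, Prod.mk.injEq] at h
    have ha : (a : ℚ) = a' := by linarith
    have hb : (b : ℚ) = b' := by linarith
    rw [ha, hb]
  · intro v hv
    obtain ⟨a, b, rfl⟩ := (mem_LA_iff _ _).1 hv
    refine ⟨_, (mem_LB_iff _ _).2 ⟨-b, a + 2 * b, rfl⟩, ?_⟩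
    rw [isoLBLA_pointLB]
    push_cast
    ring_nf
  · intro u hu v hv
    obtain ⟨a, b, rfl⟩ := (mem_LB_iff _ _).1 hu
    obtain ⟨a', b', rfl⟩ := (mem_LB_iff _ _).1 hv
    exact B_isoLBLA_pointLB ..

end Fano
end
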